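/- Let d ≥ 1, n, k ≥ 0, and let α, β ∈ ℂ^d be unit vectors with x := |⟨α|β⟩|^2. Then tr[ P_sym^{(d,n+k)} ( (|α⟩⟨α|)^{⊗n} ⊗ (|β⟩⟨β|)^{⊗k} ) ] = (1 / C(n+k, k)) · Σ_{s=0}^{k} C(k,s) C(n,s) x^s. -/

import Mathlib

open Matrix

noncomputable section

/-- The operator `P_d(π)` on `(ℂ^d)^{⊗m}` permuting tensor factors. -/
def permMat (d m : ℕ) (π : Equiv.Perm (Fin m)) :
    Matrix (Fin m → Fin d) (Fin m → Fin d) ℂ :=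
  fun a b => if ∀ t, a t = b (π⁻¹ t) then 1 else 0

/-- The orthogonal projector `P_sym^{(d,m)} = (1/m!) ∑_{π ∈ S_m} P_d(π)`. -/
def psym (d m : ℕ) : Matrix (Fin m → Fin d) (Fin m → Fin d) ℂ :=
  (m.factorial : ℂ)⁻¹ • ∑ π : Equiv.Perm (Fin m), permMat d m π

/-- The product operator `(|α⟩⟨α|)^{⊗n} ⊗ (|β⟩⟨β|)^{⊗k}` on `(ℂ^d)^{⊗(n+k)}`. -/
def prodPow (d n k : ℕ) (α β : Fin d → ℂ) :
    Matrix (Fin (n + k) → Fin d) (Fin (n + k) → Fin d) ℂ :=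
  fun a b =>
    (∏ t : Fin n, α (a (Fin.castAdd k t)) * (starRingEnd ℂ) (α (b (Fin.castAdd k t)))) *
      ∏ t : Fin k, β (a (Fin.natAdd n t)) * (starRingEnd ℂ) (β (b (Fin.natAdd n t)))

/-- The trace of a permutation operator against a product of rank-one operators. -/
theorem trace_permMat_mul_prod (d m : ℕ) (π : Equiv.Perm (Fin m)) (v : Fin m → Fin d → ℂ) :
    Matrix.trace (permMat d m π *
      Matrix.of fun a b => ∏ t, v t (a t) * (starRingEnd ℂ) (v t (b t))) =
      ∏ t, ∑ i, (starRingEnd ℂ) (v (π t) i) * v t i := by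
  rw [Finset.prod_univ_sum, Fintype.piFinset_univ, Matrix.trace_mul_comm]
  simp only [Matrix.trace, Matrix.diag, Matrix.mul_apply, Matrix.of_apply]
  refine Finset.sum_congr rfl fun b _ => ?_
  rw [Finset.sum_eq_single (fun t => b (π⁻¹ t))]
  · simp only [permMat, implies_true, if_true, mul_one, Finset.prod_mul_distrib]
    rw [mul_comm, ← Equiv.prod_comp π (fun t => (starRingEnd ℂ) (v t (b (π⁻¹ t))))]
    simp
  · intro a _ ha
    rw [permMat, if_neg fun h => ha (funext h), mul_zero]
  · simp

/-- Summing a function of the image of `B` over all permutations counts every subset of the same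
cardinality equally often. -/
theorem sum_perm_map_eq {ι : Type*} [Fintype ι] [DecidableEq ι] (B : Finset ι)
    (f : Finset ι → ℂ) :
    ((Fintype.card ι).factorial : ℂ)⁻¹ * ∑ π : Equiv.Perm ι, f (B.map π.toEmbedding) =
      1 / ((Fintype.card ι).choose B.card : ℂ) *
        ∑ S ∈ Finset.powersetCard B.card Finset.univ, f S := by
  have maps : ∀ π ∈ (Finset.univ : Finset (Equiv.Perm ι)),
      B.map π.toEmbedding ∈ Finset.powersetCard B.card Finset.univ := fun π _ => by
    simp [Finset.mem_powersetCard]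
  have fiber : ∀ S ∈ Finset.powersetCard B.card Finset.univ,
      (Finset.univ.filter fun π : Equiv.Perm ι => B.map π.toEmbedding = S).card =
        (Finset.univ.filter fun π : Equiv.Perm ι => B.map π.toEmbedding = B).card := by
    intro S hS
    have hS : S.card = B.card := (Finset.mem_powersetCard.1 hS).2
    let e : {x // x ∈ B} ≃ {x // x ∈ S} := Finset.equivOfCardEq hS.symm
    let σ : Equiv.Perm ι := e.extendSubtype
    have hσ : B.map σ.toEmbedding = S := by
      refine Finset.eq_of_subset_of_card_le ?_ (by simp [hS])
      intro x hx
      obtain ⟨y, hy, rfl⟩ := Finset.mem_map.1 hx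
      exact e.extendSubtype_mem y hy
    refine (Finset.card_equiv (Equiv.mulLeft σ) fun π => ?_).symm
    have : B.map (σ * π).toEmbedding = (B.map π.toEmbedding).map σ.toEmbedding := by
      rw [Finset.map_map]; rfl
    simp only [Finset.mem_filter, Finset.mem_univ, true_and, Equiv.coe_mulLeft, this]
    conv_rhs => rw [← hσ]
    exact (Finset.map_injective _).eq_iff.symm
  set c := (Finset.univ.filter fun π : Equiv.Perm ι => B.map π.toEmbedding = B).card with hc
  have total : (Fintype.card ι).factorial = (Fintype.card ι).choose B.card * c := by
    rw [← Fintype.card_perm, ← Finset.card_univ, Finset.card_eq_sum_card_fiberwise maps,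
      Finset.sum_congr rfl fiber]
    simp [Finset.card_univ]
  have sum_eq : ∑ π : Equiv.Perm ι, f (B.map π.toEmbedding) =
      (c : ℂ) * ∑ S ∈ Finset.powersetCard B.card Finset.univ, f S := by
    rw [← Finset.sum_fiberwise_of_maps_to maps, Finset.mul_sum]
    refine Finset.sum_congr rfl fun S hS => ?_
    rw [Finset.sum_congr rfl fun π hπ => by rw [(Finset.mem_filter.1 hπ).2],
      Finset.sum_const, fiber S hS, nsmul_eq_mul]
  have hne : ((Fintype.card ι).choose B.card : ℂ) * c ≠ 0 := by
    rw [← Nat.cast_mul, ← total]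
    exact_mod_cast (Fintype.card ι).factorial_ne_zero
  rw [sum_eq, total, Nat.cast_mul]
  have h1 := left_ne_zero_of_mul hne
  have h2 := right_ne_zero_of_mul hne
  field_simp

open Polynomial in
/-- The generating function of the intersection sizes with `Bᶜ` of the subsets of size `k`. -/
theorem sum_powersetCard_pow_card_sdiff {ι : Type*} [Fintype ι] [DecidableEq ι] (B : Finset ι)
    (k : ℕ) (x : ℂ) :
    ∑ S ∈ Finset.powersetCard k Finset.univ, x ^ (S \ B).card =
      ∑ s ∈ Finset.range (k + 1),
        (B.card.choose (k - s) : ℂ) * (Bᶜ.card.choose s : ℂ) * x ^ s := by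
  have expand : ∏ i : ι, (1 + (if i ∈ B then X else C x * X : ℂ[X])) =
      ∑ S : Finset ι, C (x ^ (S \ B).card) * X ^ S.card := by
    rw [Finset.prod_one_add, Finset.powerset_univ]
    refine Finset.sum_congr rfl fun S _ => ?_
    rw [Finset.prod_ite, Finset.prod_const, Finset.prod_const, mul_pow, mul_left_comm, ← pow_add,
      Finset.card_filter_add_card_filter_not, Finset.filter_notMem_eq_sdiff, C_pow]
  have factor : ∏ i : ι, (1 + (if i ∈ B then X else C x * X : ℂ[X])) =
      ((1 + X) ^ Bᶜ.card).comp (C x * X) * (1 + X) ^ B.card := by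
    rw [← Finset.prod_mul_prod_compl B, mul_comm]
    congr 1
    · rw [Finset.prod_congr rfl fun i hi => by rw [if_neg (Finset.mem_compl.1 hi)],
        Finset.prod_const]
      simp
    · rw [Finset.prod_congr rfl fun i hi => by rw [if_pos hi], Finset.prod_const]
  have key := congrArg (fun p => coeff p k) (expand.symm.trans factor)
  simp only [finsetSum_coeff, coeff_C_mul_X_pow] at key
  simp only [coeff_mul, comp_C_mul_X_coeff, coeff_one_add_X_pow] at key
  rw [Finset.Nat.sum_antidiagonal_eq_sum_range_succ_mk] at key
  rw [Finset.sum_congr rfl fun s _ => show (B.card.choose (k - s) : ℂ) * (Bᶜ.card.choose s : ℂ) *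
    x ^ s = (Bᶜ.card.choose s : ℂ) * x ^ s * (B.card.choose (k - s) : ℂ) by ring, ← key]
  rw [← Finset.sum_filter]
  refine Finset.sum_congr ?_ fun _ _ => rfl
  ext S
  simp [Finset.mem_powersetCard, eq_comm]

/-- A product over a permutation of a two-block Gram matrix depends only on the number of elements
leaving the block `B`. -/
theorem prod_perm_two_block {ι : Type*} [Fintype ι] [DecidableEq ι] (B : Finset ι)
    (π : Equiv.Perm ι) (z w : ℂ) :
    ∏ t, (if t ∈ B then (if π t ∈ B then 1 else z) else (if π t ∈ B then w else 1)) =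
      (z * w) ^ (B.map π.toEmbedding \ B).card := by
  have hz : (B.filter fun t => π t ∉ B).card = (B.map π.toEmbedding \ B).card := by
    rw [← Finset.card_map π.toEmbedding]
    congr 1
    ext x
    simp only [Finset.mem_map, Finset.mem_filter, Finset.mem_sdiff, Equiv.coe_toEmbedding]
    grind
  have hw : (Bᶜ.filter fun t => π t ∈ B).card = (B.map π.toEmbedding \ B).card := by
    rw [Finset.card_sdiff_comm (Finset.card_map _), ← Finset.card_map π.toEmbedding]
    congr 1
    ext x
    simp only [Finset.mem_map, Finset.mem_filter, Finset.mem_sdiff, Finset.mem_compl,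
      Equiv.coe_toEmbedding]
    constructor
    · rintro ⟨t, ⟨ht, htB⟩, rfl⟩
      exact ⟨htB, by simpa using ht⟩
    · rintro ⟨hx, h⟩
      exact ⟨π.symm x, ⟨fun h' => h ⟨_, h', by simp⟩, by simpa using hx⟩, by simp⟩
  rw [← Finset.prod_mul_prod_compl B,
    Finset.prod_congr rfl (g := fun t => if π t ∈ B then 1 else z) fun t ht => if_pos ht,
    Finset.prod_congr (s₁ := Bᶜ) rfl (g := fun t => if π t ∈ B then w else 1)
      fun t ht => if_neg (Finset.mem_compl.1 ht),
    Finset.prod_ite, Finset.prod_ite]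
  simp only [Finset.prod_const_one, Finset.prod_const, one_mul, mul_one]
  rw [hz, hw, mul_pow]

/-- For unit vectors `α, β` with `x = |⟨α|β⟩|²`,
`tr[P_sym^{(d,n+k)} (α^{⊗n} ⊗ β^{⊗k})] = (1/C(n+k,k)) ∑_{s=0}^k C(k,s)C(n,s) x^s`. -/
theorem trace_psym_product_powers
    (d n k : ℕ) (hd : 1 ≤ d) (α β : Fin d → ℂ)
    (hα : ∑ i, ‖α i‖ ^ 2 = 1) (hβ : ∑ i, ‖β i‖ ^ 2 = 1) :
    Matrix.trace (psym d (n + k) * prodPow d n k α β) =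
      (1 / ((n + k).choose k : ℂ)) *
        ∑ s ∈ Finset.range (k + 1),
          (k.choose s : ℂ) * (n.choose s : ℂ) *
            (((‖∑ i, (starRingEnd ℂ) (α i) * β i‖ ^ 2 : ℝ) : ℂ)) ^ s := by
  classical
  set B : Finset (Fin (n + k)) := Finset.univ.map (Fin.natAddEmb n) with hB
  set z : ℂ := ∑ i, (starRingEnd ℂ) (α i) * β i with hz
  let v : Fin (n + k) → Fin d → ℂ := fun t => if t ∈ B then β else α
  have hBcard : B.card = k := by simp [hB]
  have hBc : Bᶜ.card = n := by rw [Finset.card_compl, hBcard]; simp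
  have hleft : ∀ t : Fin n, Fin.castAdd k t ∉ B := fun t ht => by
    obtain ⟨s, -, hs⟩ := Finset.mem_map.1 ht
    have := congrArg Fin.val hs
    simp at this
    omega
  have hright : ∀ t : Fin k, Fin.natAdd n t ∈ B := fun t =>
    Finset.mem_map.2 ⟨t, Finset.mem_univ _, rfl⟩
  have hprod : prodPow d n k α β =
      Matrix.of fun a b => ∏ t, v t (a t) * (starRingEnd ℂ) (v t (b t)) := by
    funext a b
    simp only [prodPow, Matrix.of_apply, v, Fin.prod_univ_add, hleft, hright, if_true, if_false]
  have gram_self : ∀ u : Fin d → ℂ, ∑ i, ‖u i‖ ^ 2 = 1 →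
      ∑ i, (starRingEnd ℂ) (u i) * u i = 1 := fun u hu => by
    simp only [Complex.conj_mul']
    exact_mod_cast hu
  have hw : ∑ i, (starRingEnd ℂ) (β i) * α i = (starRingEnd ℂ) z := by
    simp [hz, map_sum, mul_comm]
  have hx : z * (starRingEnd ℂ) z = ((‖z‖ ^ 2 : ℝ) : ℂ) := by
    rw [Complex.mul_conj']; push_cast; rfl
  have hgram : ∀ (π : Equiv.Perm (Fin (n + k))) (t : Fin (n + k)),
      ∑ i, (starRingEnd ℂ) (v (π t) i) * v t i =
        if t ∈ B then (if π t ∈ B then 1 else z)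
          else (if π t ∈ B then (starRingEnd ℂ) z else 1) := fun π t => by
    by_cases h1 : t ∈ B <;> by_cases h2 : π t ∈ B <;>
      simp only [v, h1, h2, if_true, if_false, gram_self _ hα, gram_self _ hβ, hw, ← hz]
  have htrace : ∀ π : Equiv.Perm (Fin (n + k)),
      Matrix.trace (permMat d (n + k) π * prodPow d n k α β) =
        ((‖z‖ ^ 2 : ℝ) : ℂ) ^ (B.map π.toEmbedding \ B).card := fun π => by
    rw [hprod, trace_permMat_mul_prod, Finset.prod_congr rfl fun t _ => hgram π t,
      prod_perm_two_block, hx]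
  have havg := sum_perm_map_eq B fun S => ((‖z‖ ^ 2 : ℝ) : ℂ) ^ (S \ B).card
  rw [Fintype.card_fin, hBcard] at havg
  rw [psym, Matrix.smul_mul, Matrix.trace_smul, Finset.sum_mul, Matrix.trace_sum,
    Finset.sum_congr rfl fun π _ => htrace π, smul_eq_mul, havg,
    sum_powersetCard_pow_card_sdiff, hBcard, hBc]
  congr 1
  refine Finset.sum_congr rfl fun s hs => ?_
  rw [Nat.choose_symm (Nat.lt_succ_iff.1 (Finset.mem_range.1 hs))]
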